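/- arXiv:2005.03783 — 3 statements merged into one kernel-verified Lean document; each statement's English description precedes it below -/
import Mathlib

section
/- Let X be a compact metric space and let φ : ℝ × X → X be a continuous flow (φ(0, x) = x and φ(t + u, x) = φ(u, φ(t, x)) for all t, u ∈ ℝ, x ∈ X). Then for every continuous function h : X → S¹ there exists a unique continuous function C : ℝ × X → ℝ satisfying the 1-cocycle identity C(t + u, x) = C(u, φ(t, x)) + C(t, x) for all t, u ∈ ℝ and x ∈ X, and such that h(φ(t, x)) = exp(2πi·C(t, x)) · h(x) for all t ∈ ℝ and x ∈ X. -/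
open Real

/-- Two continuous real functions on a connected space that agree at a point and have the same
image under `Circle.exp` are equal. -/
theorem eq_of_circle_exp_eq {A : Type*} [TopologicalSpace A] [PreconnectedSpace A] {f g : A → ℝ}
    (hf : Continuous f) (hg : Continuous g) (h : ∀ a, Circle.exp (f a) = Circle.exp (g a)) (a : A)
    (ha : f a = g a) : f = g :=
  Circle.isCoveringMap_exp.eq_of_comp_eq hf hg (funext h) a ha

/-- The variation of a circle-valued function along the orbits of `φ` has a continuous
real-valued argument vanishing at time `0`. -/
theorem exists_circle_exp_lift {X : Type*} [TopologicalSpace X] (φ : ℝ × X → X)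
    (hφ_cont : Continuous φ) (hφ_zero : ∀ x : X, φ (0, x) = x) (h : X → Circle)
    (hh : Continuous h) :
    ∃ D : ℝ × X → ℝ, Continuous D ∧ (∀ x, D (0, x) = 0) ∧
      ∀ t x, h (φ (t, x)) = Circle.exp (D (t, x)) * h x := by
  let H : C(unitInterval × (ℝ × X), Circle) :=
    ⟨fun p => h (φ (p.1 * p.2.1, p.2.2)) / h p.2.2, by fun_prop⟩
  have H_zero (a : ℝ × X) : H (0, a) = Circle.exp ((0 : C(ℝ × X, ℝ)) a) := by
    simp [H, hφ_zero]
  let L := Circle.isCoveringMap_exp.liftHomotopy H 0 H_zero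
  have hL_zero (a : ℝ × X) : L (0, a) = 0 :=
    Circle.isCoveringMap_exp.liftHomotopy_zero H 0 H_zero a
  have hL (p : unitInterval × (ℝ × X)) : Circle.exp (L p) = H p :=
    congrFun (Circle.isCoveringMap_exp.liftHomotopy_lifts H 0 H_zero) p
  refine ⟨fun a => L (1, a), by fun_prop, fun x => ?_, fun t x => ?_⟩
  · exact congrFun (eq_of_circle_exp_eq (f := fun s => L (s, (0, x))) (g := fun _ => 0)
      (by fun_prop) continuous_const (fun s => by simp [hL, H, hφ_zero]) 0 (hL_zero _)) 1
  · simp [hL, H]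

/-- Let `φ` be a continuous flow on a compact metric space `X`. For every continuous
function `h : X → S¹ ⊆ ℂ` there is a unique continuous `1`-cocycle
`C : ℝ × X → ℝ` associated to `h`, i.e. a continuous function satisfying
`C (t + u, x) = C (u, φ (t, x)) + C (t, x)` and
`h (φ (t, x)) = exp (2πi C (t, x)) * h x` for all `t, u ∈ ℝ` and `x ∈ X`. -/
theorem exists_unique_cocycle_of_circle_valued
    {X : Type*} [MetricSpace X] [CompactSpace X]
    (φ : ℝ × X → X) (hφ_cont : Continuous φ)
    (hφ_zero : ∀ x : X, φ (0, x) = x)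
    (hφ_add : ∀ (t u : ℝ) (x : X), φ (t + u, x) = φ (u, φ (t, x)))
    (h : X → ℂ) (hh_cont : Continuous h) (hh_circle : ∀ x, ‖h x‖ = 1) :
    ∃! C : ℝ × X → ℝ, Continuous C ∧
      (∀ (t u : ℝ) (x : X), C (t + u, x) = C (u, φ (t, x)) + C (t, x)) ∧
      (∀ (t : ℝ) (x : X),
        h (φ (t, x)) = Complex.exp (2 * π * Complex.I * C (t, x)) * h x) := by
  obtain ⟨k, hk_cont, hk⟩ : ∃ k : X → Circle, Continuous k ∧ ∀ x, (k x : ℂ) = h x :=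
    ⟨fun x => ⟨h x, mem_sphere_zero_iff_norm.2 (hh_circle x)⟩, hh_cont.subtype_mk _, fun _ => rfl⟩
  obtain ⟨D, hD_cont, hD_zero, hD⟩ := exists_circle_exp_lift φ hφ_cont hφ_zero k hk_cont
  have key (C : ℝ × X → ℝ) (t : ℝ) (x : X) :
      h (φ (t, x)) = Complex.exp (2 * π * Complex.I * C (t, x)) * h x ↔
        Circle.exp (2 * π * C (t, x)) = Circle.exp (D (t, x)) := by
    have hx : h x ≠ 0 := norm_ne_zero_iff.1 (by simp [hh_circle x])
    have hDx : h (φ (t, x)) = Complex.exp (D (t, x) * Complex.I) * h x := by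
      rw [← hk, ← hk, hD, Circle.coe_mul, Circle.coe_exp]
    rw [hDx, mul_left_inj' hx, ← Circle.coe_inj, Circle.coe_exp, Circle.coe_exp, eq_comm]
    push_cast
    rw [mul_right_comm]
  have hD_add (t u : ℝ) (x : X) : D (t + u, x) = D (u, φ (t, x)) + D (t, x) := by
    refine congrFun (eq_of_circle_exp_eq (f := fun u => D (t + u, x))
      (g := fun u => D (u, φ (t, x)) + D (t, x)) (by fun_prop) (by fun_prop) (fun u => ?_) 0
      (by simp [hD_zero])) u
    refine mul_right_cancel (b := k x) ?_
    rw [← hD, Circle.exp_add, mul_assoc, ← hD, ← hD]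
    simp only [hφ_add]
  refine ⟨fun p => D p / (2 * π), ⟨by fun_prop, fun t u x => ?_, fun t x => ?_⟩, ?_⟩
  · simp only [hD_add, add_div]
  · rw [key (fun p => D p / (2 * π))]
    congr 1
    field_simp
  · rintro C ⟨hC_cont, hC_add, hC⟩
    funext ⟨t, x⟩
    have hC_zero : C (0, x) = 0 := by simpa [hφ_zero] using hC_add 0 0 x
    have hCD : 2 * π * C (t, x) = D (t, x) :=
      congrFun (eq_of_circle_exp_eq (f := fun t => 2 * π * C (t, x)) (g := fun t => D (t, x))
        (by fun_prop) (by fun_prop) (fun t => (key C t x).1 (hC t x)) 0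
        (by simp [hC_zero, hD_zero])) t
    simp only [← hCD]
    field_simp
end

section
/- (Poincaré) Let F : ℝ → ℝ be a lift of an orientation-preserving homeomorphism of the circle (a strictly increasing continuous bijection with F(x + 1) = F(x) + 1 for all x), and suppose its translation number τ(F) = lim_{n→∞} Fⁿ(0)/n is irrational. Then F is semiconjugate to the translation by τ(F): there exists a continuous monotone (nondecreasing) map H : ℝ → ℝ with H(x + 1) = H(x) + 1 for all x ∈ ℝ and H(F(x)) = H(x) + τ(F) for all x ∈ ℝ. -/
open Filter Topology

/-- A degree one monotone map that semiconjugates a surjective map to an irrational translation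
has dense range. -/
theorem CircleDeg1Lift.denseRange_of_semiconj_irrational_translate (h : CircleDeg1Lift)
    {F : ℝ → ℝ} (hF : Function.Surjective F) {τ : ℝ} (hτ : Irrational τ)
    (hsemi : ∀ x, h (F x) = h x + τ) : DenseRange h := by
  have hmem : ∀ y ∈ AddSubgroup.closure {1, τ}, ∀ x, h x + y ∈ Set.range h := by
    have hadd : ∀ y ∈ ({1, τ} : Set ℝ), ∀ x, h x + y ∈ Set.range h ∧ h x - y ∈ Set.range h := by
      rintro y (rfl | rfl) x
      · exact ⟨⟨x + 1, h.map_add_one x⟩, ⟨x - 1, by simpa using h.map_sub_nat x 1⟩⟩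
      · obtain ⟨z, rfl⟩ := hF x
        exact ⟨⟨F (F z), hsemi _⟩, ⟨z, by rw [hsemi]; ring⟩⟩
    intro y hy
    induction hy using AddSubgroup.closure_induction'' with
    | zero => exact fun x => ⟨x, by simp⟩
    | mem y hy => exact fun x => (hadd y hy x).1
    | neg_mem y hy => exact fun x => by simpa [sub_eq_add_neg] using (hadd y hy x).2
    | add y z _ _ ihy ihz =>
      intro x
      obtain ⟨w, hw⟩ := ihy x
      rw [← add_assoc, ← hw]
      exact ihz w
  have hdense : Dense (AddSubgroup.closure {1, τ} : Set ℝ) := by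
    rw [Set.pair_comm]
    exact dense_addSubgroupClosure_pair_iff.2 (by simpa using hτ)
  refine ((Homeomorph.addLeft (h 0)).surjective.denseRange.dense_image
    (Homeomorph.addLeft (h 0)).continuous hdense).mono ?_
  rintro _ ⟨y, hy, rfl⟩
  exact hmem y hy 0

/-- (Poincaré) Let `F : ℝ → ℝ` be a lift of an orientation-preserving circle homeomorphism
(a strictly increasing continuous bijection with `F (x + 1) = F x + 1`) whose translation
number `τ = lim Fⁿ(0)/n` is irrational. Then `F` is semiconjugate to the translation by
`τ`: there is a continuous nondecreasing `H : ℝ → ℝ` with `H (x + 1) = H x + 1` and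
`H (F x) = H x + τ` for all `x`. -/
theorem semiconjugacy_of_irrational_rotation_number
    (F : ℝ → ℝ) (hF_cont : Continuous F) (hF_mono : StrictMono F)
    (hF_bij : Function.Bijective F) (hF_per : ∀ x : ℝ, F (x + 1) = F x + 1)
    (τ : ℝ) (hτ : Tendsto (fun n : ℕ => F^[n] 0 / (n : ℝ)) atTop (𝓝 τ))
    (hτ_irr : Irrational τ) :
    ∃ H : ℝ → ℝ, Continuous H ∧ Monotone H ∧
      (∀ x : ℝ, H (x + 1) = H x + 1) ∧ ∀ x : ℝ, H (F x) = H x + τ := by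
  let f : CircleDeg1Lift := ⟨⟨F, hF_mono.monotone⟩, hF_per⟩
  let g : CircleDeg1Liftˣ := CircleDeg1Lift.translate (Multiplicative.ofAdd τ)
  have hf : f.translationNumber = τ := f.translationNumber_eq_of_tendsto₀ hτ
  obtain ⟨h, hh⟩ := CircleDeg1Lift.semiconj_of_bijective_of_translationNumber_eq
    (f₁ := f) (f₂ := g) hF_bij (CircleDeg1Lift.isUnit_iff_bijective.1 g.isUnit)
    (hf.trans (CircleDeg1Lift.translationNumber_translate τ).symm)
  have hsemi : ∀ x, h (F x) = h x + τ := fun x =>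
    (hh x).trans ((CircleDeg1Lift.translate_apply τ (h x)).trans (add_comm _ _))
  exact ⟨h, h.monotone.continuous_of_denseRange
    (h.denseRange_of_semiconj_irrational_translate hF_bij.surjective hτ_irr hsemi),
    h.monotone, h.map_add_one, hsemi⟩
end

section
/- (Misiurewicz–Ziemian) Let F : ℝ² → ℝ² be a homeomorphism satisfying F(x + m) = F(x) + m for all x ∈ ℝ² and all m ∈ ℤ² (a lift of a homeomorphism of the torus 𝕋² isotopic to the identity). Define the rotation set ρ(F) = { v ∈ ℝ² : there exist sequences n_k → ∞ of positive integers and x_k ∈ ℝ² with (F^{n_k}(x_k) − x_k)/n_k → v }. Then ρ(F) is a compact convex subset of ℝ². -/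
open Filter Topology

/-- If `‖δ‖ < ‖z‖`, then `(z + δ) / (z - δ)` has positive real part. -/
lemma Complex.add_div_sub_mem_slitPlane {z δ : ℂ} (h : ‖δ‖ < ‖z‖) :
    (z + δ) / (z - δ) ∈ Complex.slitPlane := by
  have hne : z - δ ≠ 0 := fun h0 => by
    rw [sub_eq_zero.1 h0] at h
    exact lt_irrefl _ h
  have hsq : Complex.normSq δ < Complex.normSq z := by
    rw [Complex.normSq_eq_norm_sq, Complex.normSq_eq_norm_sq]
    gcongr
  rw [Complex.normSq_apply, Complex.normSq_apply] at hsq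
  left
  rw [Complex.div_re, ← add_div]
  refine div_pos ?_ (Complex.normSq_pos.2 hne)
  simp only [Complex.add_re, Complex.sub_re, Complex.add_im, Complex.sub_im]
  nlinarith

/-- A continuous nowhere vanishing complex function on the plane has a continuous logarithm. -/
lemma exists_continuous_exp_eq {g : ℝ × ℝ → ℂ} (hg : Continuous g) (h0 : ∀ p, g p ≠ 0) :
    ∃ f : ℝ × ℝ → ℂ, Continuous f ∧ ∀ p, Complex.exp (f p) = g p := by
  have hsc : IsSimplyConnected (Set.univ : Set (ℝ × ℝ)) := by
    have := (convex_univ (𝕜 := ℝ) (E := ℝ × ℝ)).contractibleSpace Set.univ_nonempty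
    exact SimplyConnectedSpace.ofContractible _
  obtain ⟨f, hf, hfg⟩ := Complex.exists_continuousOn_eqOn_exp_comp hsc isOpen_univ
    hg.continuousOn (by simpa using h0)
  exact ⟨f, continuousOn_univ.1 hf, fun p => hfg (Set.mem_univ p)⟩

/-- If the difference of two points of a plane curve `γ` never equals `(γ 1 - γ 0) / 2 + δ`,
then `γ` passes within `‖δ‖` of the midpoint of `γ 0` and `γ 1`. -/
lemma exists_norm_sub_midpoint_le {γ : ℝ → ℂ} (hγ : Continuous γ) {δ : ℂ}
    (h : ∀ s t, γ t - γ s ≠ (γ 1 - γ 0) / 2 + δ) :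
    ∃ t, ‖γ t - (γ 0 + γ 1) / 2‖ ≤ ‖δ‖ := by
  by_contra! hfar
  set η : ℝ → ℂ := fun t => γ t - (γ 0 + γ 1) / 2 with hη
  have hηc : Continuous η := by fun_prop
  obtain ⟨ψ, hψ, hψexp⟩ := exists_continuous_exp_eq
    (g := fun p : ℝ × ℝ => γ p.2 - γ p.1 - ((γ 1 - γ 0) / 2 + δ)) (by fun_prop)
    (fun p => sub_ne_zero.2 (h _ _))
  have hcov {f : ℝ → ℂ} (hf : Continuous f) {c : ℂ} (hc : ∀ t, Complex.exp (f t) = c) :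
      f 0 = f 1 :=
    Complex.isCoveringMap_exp.const_of_comp hf (fun a b => Subtype.ext ((hc a).trans (hc b).symm))
      0 1
  have hne (t : ℝ) : η t - δ ≠ 0 := fun h0 => by
    have := hfar t
    change ‖δ‖ < ‖η t‖ at this
    rw [sub_eq_zero.1 h0] at this
    exact lt_irrefl _ this
  have hslit (t : ℝ) : (η t + δ) / (η t - δ) ∈ Complex.slitPlane :=
    Complex.add_div_sub_mem_slitPlane (hfar t)
  have hdiag : ψ (0, 0) = ψ (1, 1) :=
    hcov (f := fun t => ψ (t, t)) (c := -((γ 1 - γ 0) / 2 + δ)) (by fun_prop)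
      (fun t => by simp [hψexp])
  have hlogc : Continuous fun t => Complex.log ((η t + δ) / (η t - δ)) :=
    ((hηc.add continuous_const).div (hηc.sub continuous_const) hne).clog hslit
  have hside := hcov (f := fun t => ψ (t, 1) - ψ (0, t) - Complex.log ((η t + δ) / (η t - δ)))
    (c := -1) (by fun_prop) (fun t => by
      have h1 := Complex.slitPlane_ne_zero (hslit t)
      have h2 := hne t
      have h3 : η t + δ ≠ 0 := fun h0 => h1 (by simp [h0])
      rw [Complex.exp_sub, Complex.exp_sub, hψexp, hψexp, Complex.exp_log h1]
      have e1 : γ 1 - γ t - ((γ 1 - γ 0) / 2 + δ) = -(η t + δ) := by simp only [hη]; ring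
      have e2 : γ t - γ 0 - ((γ 1 - γ 0) / 2 + δ) = η t - δ := by simp only [hη]; ring
      simp only [e1, e2]
      generalize η t + δ = u at h3
      generalize η t - δ = v at h2
      field_simp)
  have hinv : (η 1 + δ) / (η 1 - δ) = ((η 0 + δ) / (η 0 - δ))⁻¹ := by
    have e : η 1 = - η 0 := by simp only [hη]; ring
    rw [e, inv_div, ← neg_div_neg_eq]
    congr 1 <;> ring
  have hlog : Complex.log ((η 1 + δ) / (η 1 - δ)) = -Complex.log ((η 0 + δ) / (η 0 - δ)) := by
    rw [hinv, Complex.log_inv _ (Complex.slitPlane_arg_ne_pi (hslit 0))]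
  simp only [hlog, hdiag] at hside
  have hhalf : ψ (0, 1) - ψ (1, 1) = Complex.log ((η 0 + δ) / (η 0 - δ)) := by
    linear_combination hside / 2
  have hexp := congrArg Complex.exp hhalf
  have h1 := Complex.slitPlane_ne_zero (hslit 0)
  rw [Complex.exp_sub, hψexp, hψexp, Complex.exp_log h1] at hexp
  have e1 : γ 1 - γ 0 - ((γ 1 - γ 0) / 2 + δ) = -(η 0 + δ) := by simp only [hη]; ring
  have e2 : γ 1 - γ 1 - ((γ 1 - γ 0) / 2 + δ) = η 0 - δ := by simp only [hη]; ring
  simp only [e1, e2, neg_div] at hexp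
  exact h1 (self_eq_neg.1 hexp.symm)

/-- A bounded set containing the midpoint of any two of its points up to `ε` contains every
point of a segment between two of its points up to `3 * ε`. -/
lemma exists_dist_le_of_mem_segment {E : Type*} [NormedAddCommGroup E] [NormedSpace ℝ E]
    {A : Set E} (hA : Bornology.IsBounded A) {ε : ℝ} (hε : 0 < ε)
    (hmid : ∀ a ∈ A, ∀ b ∈ A, ∃ c ∈ A, dist c (midpoint ℝ a b) ≤ ε)
    {a b p : E} (ha : a ∈ A) (hb : b ∈ A) (hp : p ∈ segment ℝ a b) :
    ∃ c ∈ A, dist c p ≤ 3 * ε := by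
  have key (n : ℕ) : ∀ a ∈ A, ∀ b ∈ A, ∀ p ∈ segment ℝ a b,
      ∃ c ∈ A, dist c p ≤ 2 * ε + Metric.diam A / 2 ^ n := by
    induction n with
    | zero =>
      intro a ha b hb p hp
      refine ⟨a, ha, ?_⟩
      have h1 : dist a p ≤ dist a b := by
        linarith [dist_add_dist_of_mem_segment hp, dist_nonneg (x := p) (y := b)]
      have h2 := Metric.dist_le_diam_of_mem hA ha hb
      simp only [pow_zero, div_one]
      linarith
    | succ n ih =>
      have half : ∀ a ∈ A, ∀ b ∈ A, ∀ p' ∈ segment ℝ a b,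
          ∃ c ∈ A, dist c (midpoint ℝ a p') ≤ 2 * ε + Metric.diam A / 2 ^ (n + 1) := by
        intro a ha b hb p' hp'
        obtain ⟨q, hq, hqp⟩ := ih a ha b hb p' hp'
        obtain ⟨c, hc, hcq⟩ := hmid a ha q hq
        refine ⟨c, hc, (dist_triangle c (midpoint ℝ a q) _).trans ?_⟩
        have h1 := dist_midpoint_midpoint_le a q a p'
        rw [dist_self] at h1
        have h2 : Metric.diam A / 2 ^ (n + 1) = Metric.diam A / 2 ^ n / 2 := by
          rw [pow_succ, div_div]
        linarith
      intro a ha b hb p hp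
      rw [segment_eq_image_lineMap] at hp
      obtain ⟨t, ⟨ht0, ht1⟩, rfl⟩ := hp
      rcases le_total t (1 / 2) with ht | ht
      · convert half a ha b hb (AffineMap.lineMap a b (2 * t)) ?_ using 5
        · simp only [midpoint_eq_smul_add, AffineMap.lineMap_apply_module, invOf_eq_inv]
          module
        · rw [segment_eq_image_lineMap]
          exact ⟨_, ⟨by linarith, by linarith⟩, rfl⟩
      · convert half b hb a ha (AffineMap.lineMap a b (2 * t - 1)) ?_ using 5
        · simp only [midpoint_eq_smul_add, AffineMap.lineMap_apply_module, invOf_eq_inv]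
          module
        · rw [segment_symm, segment_eq_image_lineMap]
          exact ⟨_, ⟨by linarith, by linarith⟩, rfl⟩
  have hlim : Tendsto (fun n : ℕ => Metric.diam A / 2 ^ n) atTop (𝓝 0) :=
    tendsto_const_nhds.div_atTop (tendsto_pow_atTop_atTop_of_one_lt one_lt_two)
  obtain ⟨n, hn⟩ := (hlim.eventually_lt_const hε).exists
  obtain ⟨c, hc, hcp⟩ := key n a ha b hb p hp
  exact ⟨c, hc, by linarith⟩

/-- A bounded set in a finite-dimensional space which is midpoint convex up to `ε` is convex up
to a constant multiple of `ε`. -/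
lemma exists_dist_le_of_mem_convexHull {E : Type*} [NormedAddCommGroup E] [NormedSpace ℝ E]
    [FiniteDimensional ℝ E] {A : Set E} (hA : Bornology.IsBounded A) {ε : ℝ} (hε : 0 < ε)
    (hmid : ∀ a ∈ A, ∀ b ∈ A, ∃ c ∈ A, dist c (midpoint ℝ a b) ≤ ε)
    {p : E} (hp : p ∈ convexHull ℝ A) :
    ∃ c ∈ A, dist c p ≤ 3 * ε * (Module.finrank ℝ E + 1) := by
  have key (t : Finset E) (ht : t.Nonempty) : (t : Set E) ⊆ A → ∀ p ∈ convexHull ℝ (t : Set E),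
      ∃ c ∈ A, dist c p ≤ 3 * ε * t.card := by
    induction ht using Finset.Nonempty.cons_induction with
    | singleton a =>
      intro hs p hp
      simp only [Finset.coe_singleton, convexHull_singleton, Set.mem_singleton_iff] at hp
      subst hp
      exact ⟨p, hs (by simp), by simp [hε.le]⟩
    | cons a s has hs ih =>
      intro hsub p hp
      rw [Finset.coe_cons, Set.insert_subset_iff] at hsub
      rw [Finset.coe_cons, convexHull_insert (by simpa using hs), convexJoin_singleton_left] at hp
      simp only [Set.mem_iUnion] at hp
      obtain ⟨q, hq, hpq⟩ := hp
      obtain ⟨q', hq', hqq'⟩ := ih hsub.2 q hq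
      rw [segment_eq_image_lineMap] at hpq
      obtain ⟨t, ⟨ht0, ht1⟩, rfl⟩ := hpq
      obtain ⟨c, hc, hcp⟩ := exists_dist_le_of_mem_segment hA hε hmid hsub.1 hq'
        (p := AffineMap.lineMap a q' t) (by
          rw [segment_eq_image_lineMap]
          exact ⟨t, ⟨ht0, ht1⟩, rfl⟩)
      refine ⟨c, hc, (dist_triangle _ _ _).trans 
        ((add_le_add hcp (c := dist _ _) (d := 3 * ε * s.card) ?_).trans_eq ?_)⟩
      · refine le_trans ?_ hqq'
        rw [dist_eq_norm, AffineMap.lineMap_apply_module, AffineMap.lineMap_apply_module,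
          add_sub_add_left_eq_sub, ← smul_sub, norm_smul, Real.norm_of_nonneg ht0, dist_eq_norm]
        exact mul_le_of_le_one_left (norm_nonneg _) ht1
      · rw [Finset.card_cons]
        push_cast
        ring
  rw [convexHull_eq_union] at hp
  simp only [Set.mem_iUnion] at hp
  obtain ⟨t, htA, hind, hpt⟩ := hp
  have hne : t.Nonempty := by
    have := convexHull_nonempty_iff.1 ⟨p, hpt⟩
    simpa using this
  obtain ⟨c, hc, hcp⟩ := key t hne htA p hpt
  refine ⟨c, hc, hcp.trans ?_⟩
  have hcard : t.card ≤ Module.finrank ℝ E + 1 := by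
    have h1 := hind.card_le_finrank_succ
    rw [Fintype.card_coe] at h1
    exact h1.trans (Nat.add_le_add_right (Submodule.finrank_le _) 1)
  gcongr
  exact_mod_cast hcard

/-- Every displacement of a map commuting with integer translations is attained in the unit
square. -/
lemma exists_mem_Ico_displacement_eq {G : ℝ × ℝ → ℝ × ℝ}
    (hper : ∀ (x : ℝ × ℝ) (m : ℤ × ℤ),
      G (x + ((m.1 : ℝ), (m.2 : ℝ))) = G x + ((m.1 : ℝ), (m.2 : ℝ))) (x : ℝ × ℝ) :
    ∃ y : ℝ × ℝ, y.1 ∈ Set.Ico (0 : ℝ) 1 ∧ y.2 ∈ Set.Ico (0 : ℝ) 1 ∧ G y - y = G x - x := by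
  refine ⟨(Int.fract x.1, Int.fract x.2), ⟨Int.fract_nonneg _, Int.fract_lt_one _⟩,
    ⟨Int.fract_nonneg _, Int.fract_lt_one _⟩, ?_⟩
  have hx : x = (Int.fract x.1, Int.fract x.2) + ((⌊x.1⌋ : ℝ), (⌊x.2⌋ : ℝ)) := by
    ext <;> simp
  conv_rhs => rw [hx]
  rw [hper _ (⌊x.1⌋, ⌊x.2⌋)]
  abel

/-- An injective lift maps a segment with coordinates of length less than `1` to an arc passing
within distance `1` of the midpoint of its ends. -/
lemma exists_mem_segment_dist_midpoint_le {G : ℝ × ℝ → ℝ × ℝ} (hG : Continuous G)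
    (hinj : Function.Injective G)
    (hper : ∀ (x : ℝ × ℝ) (m : ℤ × ℤ),
      G (x + ((m.1 : ℝ), (m.2 : ℝ))) = G x + ((m.1 : ℝ), (m.2 : ℝ)))
    {x y : ℝ × ℝ} (h1 : |y.1 - x.1| < 1) (h2 : |y.2 - x.2| < 1) :
    ∃ z ∈ segment ℝ x y, dist (G z) (midpoint ℝ (G x) (G y)) ≤ 1 := by
  set e := Complex.equivRealProdCLM.symm with he
  have henorm (w : ℝ × ℝ) : ‖w‖ ≤ ‖e w‖ :=
    max_le (Complex.abs_re_le_norm (e w)) (Complex.abs_im_le_norm (e w))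
  set τ : ℝ → ℝ := fun t => Set.projIcc (0 : ℝ) 1 zero_le_one t with hτ
  have hτc : Continuous τ := continuous_subtype_val.comp continuous_projIcc
  have hτm (t : ℝ) : τ t ∈ Set.Icc (0 : ℝ) 1 := (Set.projIcc (0 : ℝ) 1 zero_le_one t).2
  have hτ0 : τ 0 = 0 := by simp [hτ]
  have hτ1 : τ 1 = 1 := by simp [hτ]
  set P : ℝ → ℝ × ℝ := fun t => AffineMap.lineMap x y (τ t) with hP
  have hPc : Continuous P := AffineMap.lineMap_continuous.comp hτc
  have hP0 : P 0 = x := by simp [hP, hτ0]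
  have hP1 : P 1 = y := by simp [hP, hτ1]
  have hPm (t : ℝ) : P t ∈ segment ℝ x y := by
    rw [segment_eq_image_lineMap]
    exact ⟨τ t, hτm t, rfl⟩
  set γ : ℝ → ℂ := fun t => e (G (P t)) with hγ
  have hγc : Continuous γ := e.continuous.comp (hG.comp hPc)
  set c : ℂ := (γ 1 - γ 0) / 2 with hc
  set m : ℤ × ℤ := (round c.re, round c.im) with hm
  set δ : ℂ := e ((m.1 : ℝ), (m.2 : ℝ)) - c with hδ
  have hδ1 : ‖δ‖ ≤ 1 := by
    refine (Complex.norm_le_abs_re_add_abs_im δ).trans ?_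
    have hre : |δ.re| ≤ 1 / 2 := abs_sub_comm c.re _ ▸ abs_sub_round c.re
    have him : |δ.im| ≤ 1 / 2 := abs_sub_comm c.im _ ▸ abs_sub_round c.im
    linarith
  have hmid (t : ℝ) : dist (G (P t)) (midpoint ℝ (G x) (G y)) ≤ ‖γ t - (γ 0 + γ 1) / 2‖ := by
    rw [dist_eq_norm]
    refine (henorm _).trans_eq ?_
    simp only [hγ, hP0, hP1, map_sub, midpoint_eq_smul_add, map_smul, map_add]
    congr 2
    rw [Complex.real_smul, invOf_eq_inv]
    push_cast
    ring
  by_cases hm0 : m = 0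
  · refine ⟨P 0, hPm 0, (hmid 0).trans ?_⟩
    have : γ 0 - (γ 0 + γ 1) / 2 = δ := by
      have : e ((m.1 : ℝ), (m.2 : ℝ)) = 0 := by rw [hm0]; simp
      rw [hδ, this, hc]
      ring
    rwa [this]
  · obtain ⟨t, ht⟩ := exists_norm_sub_midpoint_le hγc (δ := δ) (by
      intro s t hst
      have h3 : G (P t) = G (P s + ((m.1 : ℝ), (m.2 : ℝ))) := by
        rw [hper]
        apply e.injective
        rw [map_add]
        have : γ t - γ s = e ((m.1 : ℝ), (m.2 : ℝ)) := by rw [hst, hδ]; ring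
        exact sub_eq_iff_eq_add'.1 this
      have h4 := hinj h3
      simp only [hP, AffineMap.lineMap_apply_module'] at h4
      have hst1 : |τ t - τ s| ≤ 1 := by
        rw [abs_le]
        constructor <;> linarith [(hτm t).1, (hτm t).2, (hτm s).1, (hτm s).2]
      have small {k : ℤ} {d : ℝ} (hd : |d| < 1) (hk : (τ t - τ s) * d = k) : k = 0 := by
        rw [← Int.abs_lt_one_iff]
        have : |(k : ℝ)| < 1 := by
          rw [← hk, abs_mul]
          exact (mul_le_of_le_one_left (abs_nonneg _) hst1).trans_lt hd
        exact_mod_cast this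
      refine hm0 (Prod.ext (small h1 ?_) (small h2 ?_))
      · have := congrArg Prod.fst h4
        simp only [Prod.fst_add, Prod.smul_fst, Prod.fst_sub, smul_eq_mul] at this
        linear_combination this
      · have := congrArg Prod.snd h4
        simp only [Prod.snd_add, Prod.smul_snd, Prod.snd_sub, smul_eq_mul] at this
        linear_combination this)
    exact ⟨P t, hPm t, (hmid t).trans (ht.trans hδ1)⟩

/-- The displacements of an injective lift form a set which is midpoint convex up to `2`. -/
lemma exists_dist_displacement_midpoint_le {G : ℝ × ℝ → ℝ × ℝ} (hG : Continuous G)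
    (hinj : Function.Injective G)
    (hper : ∀ (x : ℝ × ℝ) (m : ℤ × ℤ),
      G (x + ((m.1 : ℝ), (m.2 : ℝ))) = G x + ((m.1 : ℝ), (m.2 : ℝ))) (x y : ℝ × ℝ) :
    ∃ z, dist (G z - z) (midpoint ℝ (G x - x) (G y - y)) ≤ 2 := by
  obtain ⟨x, hx1, hx2, hx⟩ := exists_mem_Ico_displacement_eq hper x
  obtain ⟨y, hy1, hy2, hy⟩ := exists_mem_Ico_displacement_eq hper y
  rw [← hx, ← hy]
  have h1 : |y.1 - x.1| < 1 := by
    rw [abs_lt]; constructor <;> linarith [hx1.1, hx1.2, hy1.1, hy1.2]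
  have h2 : |y.2 - x.2| < 1 := by
    rw [abs_lt]; constructor <;> linarith [hx2.1, hx2.2, hy2.1, hy2.2]
  obtain ⟨z, hz, hGz⟩ := exists_mem_segment_dist_midpoint_le hG hinj hper h1 h2
  refine ⟨z, ?_⟩
  have hxy : dist x y ≤ 1 := by
    rw [dist_comm, dist_eq_norm]
    exact max_le h1.le h2.le
  have hzm : dist z (midpoint ℝ x y) ≤ 1 := by
    refine ((convex_closedBall (midpoint ℝ x y) 1).segment_subset ?_ ?_ hz) <;>
    · rw [Metric.mem_closedBall]
      first | rw [dist_left_midpoint] | rw [dist_right_midpoint]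
      norm_num
      linarith
  have hms : midpoint ℝ (G x - x) (G y - y) = midpoint ℝ (G x) (G y) - midpoint ℝ x y := by
    simp only [midpoint_eq_smul_add]
    module
  rw [hms]
  exact (dist_sub_sub_le _ _ _ _).trans (by linarith)

/-- The set of average displacements `(F^[n] x - x) / n`. -/
def averageDisplacements (F : ℝ × ℝ → ℝ × ℝ) (n : ℕ) : Set (ℝ × ℝ) :=
  Set.range fun x => (n : ℝ)⁻¹ • (F^[n] x - x)

lemma iterate_add_intCast {F : ℝ × ℝ → ℝ × ℝ}
    (hper : ∀ (x : ℝ × ℝ) (m : ℤ × ℤ),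
      F (x + ((m.1 : ℝ), (m.2 : ℝ))) = F x + ((m.1 : ℝ), (m.2 : ℝ)))
    (n : ℕ) (x : ℝ × ℝ) (m : ℤ × ℤ) :
    F^[n] (x + ((m.1 : ℝ), (m.2 : ℝ))) = F^[n] x + ((m.1 : ℝ), (m.2 : ℝ)) :=
  (Function.Commute.iterate_left (g := fun z : ℝ × ℝ => z + ((m.1 : ℝ), (m.2 : ℝ)))
    (fun z => hper z m) n) x

lemma exists_norm_displacement_le {F : ℝ × ℝ → ℝ × ℝ} (hF : Continuous F)
    (hper : ∀ (x : ℝ × ℝ) (m : ℤ × ℤ),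
      F (x + ((m.1 : ℝ), (m.2 : ℝ))) = F x + ((m.1 : ℝ), (m.2 : ℝ))) :
    ∃ M, ∀ x, ‖F x - x‖ ≤ M := by
  obtain ⟨M, hM⟩ :=
    (isCompact_Icc (a := ((0 : ℝ), (0 : ℝ))) (b := (1, 1))).exists_bound_of_continuousOn
      (hF.sub continuous_id).continuousOn
  refine ⟨M, fun x => ?_⟩
  obtain ⟨y, hy1, hy2, hy⟩ := exists_mem_Ico_displacement_eq hper x
  rw [← hy]
  exact hM y ⟨⟨hy1.1, hy2.1⟩, ⟨hy1.2.le, hy2.2.le⟩⟩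

lemma norm_iterate_sub_le {F : ℝ × ℝ → ℝ × ℝ} {M : ℝ} (hM : ∀ x, ‖F x - x‖ ≤ M)
    (n : ℕ) (x : ℝ × ℝ) : ‖F^[n] x - x‖ ≤ n * M := by
  induction n with
  | zero => simp
  | succ n ih =>
    rw [Function.iterate_succ_apply', ← sub_add_sub_cancel _ (F^[n] x)]
    refine (norm_add_le _ _).trans ?_
    push_cast
    linarith [hM (F^[n] x)]

lemma isBounded_averageDisplacements {F : ℝ × ℝ → ℝ × ℝ} {M : ℝ} (hM : ∀ x, ‖F x - x‖ ≤ M)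
    (n : ℕ) : Bornology.IsBounded (averageDisplacements F n) := by
  refine isBounded_iff_forall_norm_le.2 ⟨(n : ℝ)⁻¹ * (n * M), ?_⟩
  rintro _ ⟨x, rfl⟩
  rw [norm_smul, norm_inv, Real.norm_natCast]
  gcongr
  exact norm_iterate_sub_le hM n x

/-- An average displacement over a long time `N` is close to a convex combination of average
displacements over time `n`. -/
lemma exists_mem_convexHull_dist_le {F : ℝ × ℝ → ℝ × ℝ} {M : ℝ} (hM : ∀ x, ‖F x - x‖ ≤ M)
    {n N : ℕ} (hn : n ≠ 0) (hN : N ≠ 0) (x : ℝ × ℝ) :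
    ∃ y ∈ convexHull ℝ (averageDisplacements F n),
      dist ((N : ℝ)⁻¹ • (F^[N] x - x)) y ≤ (N : ℝ)⁻¹ * (2 * n * M) := by
  have hn' : (n : ℝ) ≠ 0 := by exact_mod_cast hn
  have hN' : (N : ℝ) ≠ 0 := by exact_mod_cast hN
  have hM0 : 0 ≤ M := (norm_nonneg _).trans (hM 0)
  refine ⟨∑ i ∈ Finset.range N, (N : ℝ)⁻¹ • ((n : ℝ)⁻¹ • (F^[n] (F^[i] x) - F^[i] x)),
    (convex_convexHull ℝ _).sum_mem (fun _ _ => by positivity) (by simp [hN'])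
      (fun i _ => subset_convexHull ℝ _ ⟨F^[i] x, rfl⟩), ?_⟩
  have hswap : ∑ i ∈ Finset.range N, (F^[n] (F^[i] x) - F^[i] x) =
      ∑ j ∈ Finset.range n, (F^[j] (F^[N] x) - F^[j] x) := by
    simp only [← Function.iterate_add_apply, Finset.sum_sub_distrib]
    have h1 := Finset.sum_range_add (fun i => F^[i] x) n N
    have h2 := Finset.sum_range_add (fun i => F^[i] x) N n
    rw [add_comm n N, h2] at h1
    simp only [add_comm _ N]
    rw [sub_eq_sub_iff_add_eq_add, add_comm, ← h1, add_comm]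
  have hsum : F^[N] x - x = (n : ℝ)⁻¹ • ∑ _j ∈ Finset.range n, (F^[N] x - x) := by
    rw [Finset.sum_const, Finset.card_range, ← Nat.cast_smul_eq_nsmul ℝ, smul_smul,
      inv_mul_cancel₀ hn', one_smul]
  rw [← Finset.smul_sum, ← Finset.smul_sum, hswap, dist_eq_norm, ← smul_sub, norm_smul, norm_inv,
    Real.norm_natCast, hsum, ← smul_sub, ← Finset.sum_sub_distrib, norm_smul, norm_inv,
    Real.norm_natCast]
  refine mul_le_mul_of_nonneg_left ?_ (by positivity)
  have hterm : ∀ j ∈ Finset.range n,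
      ‖F^[N] x - x - (F^[j] (F^[N] x) - F^[j] x)‖ ≤ 2 * n * M := by
    intro j hj
    have hjn : (j : ℝ) ≤ n := by exact_mod_cast (Finset.mem_range.1 hj).le
    rw [sub_sub_sub_comm, ← neg_sub (F^[j] (F^[N] x)), ← neg_sub (F^[j] x), neg_sub_neg]
    refine (norm_sub_le _ _).trans ?_
    have h1 := norm_iterate_sub_le hM j x
    have h2 := norm_iterate_sub_le hM j (F^[N] x)
    have h3 := mul_le_mul_of_nonneg_right hjn hM0
    linarith
  have := norm_sum_le_of_le _ hterm
  rw [Finset.sum_const, Finset.card_range, nsmul_eq_mul] at this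
  rw [inv_mul_le_iff₀ (by positivity)]
  exact this

/-- The rotation set is the intersection of the closed convex hulls of the sets of average
displacements. -/
lemma rotation_set_eq_iInter {F : ℝ × ℝ → ℝ × ℝ} (hF : Continuous F)
    (hinj : Function.Injective F)
    (hper : ∀ (x : ℝ × ℝ) (m : ℤ × ℤ),
      F (x + ((m.1 : ℝ), (m.2 : ℝ))) = F x + ((m.1 : ℝ), (m.2 : ℝ))) :
    {v : ℝ × ℝ | ∃ (n : ℕ → ℕ) (x : ℕ → ℝ × ℝ), Tendsto n atTop atTop ∧
        Tendsto (fun k => ((n k : ℝ))⁻¹ • (F^[n k] (x k) - x k)) atTop (𝓝 v)} =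
      ⋂ n : ℕ, closure (convexHull ℝ (averageDisplacements F (n + 1))) := by
  obtain ⟨M, hM⟩ := exists_norm_displacement_le hF hper
  ext v
  simp only [Set.mem_ofPred_eq, Set.mem_iInter]
  constructor
  · rintro ⟨N, x, hN, hv⟩ n
    have hpos : ∀ᶠ k in atTop, N k ≠ 0 := hN.eventually_ne_atTop 0
    choose! y hy hdist using fun k (hk : N k ≠ 0) =>
      exists_mem_convexHull_dist_le hM n.succ_ne_zero hk (x k)
    refine mem_closure_of_tendsto (f := y) (b := atTop) ?_ (hpos.mono hy)
    refine tendsto_of_tendsto_of_dist hv ?_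
    refine squeeze_zero' (Eventually.of_forall fun _ => dist_nonneg) (hpos.mono hdist) ?_
    simpa using (tendsto_inv_atTop_zero.comp (tendsto_natCast_atTop_atTop.comp hN)).mul_const
      (2 * ((n.succ : ℕ) : ℝ) * M)
  · intro hv
    have hclose (n : ℕ) : ∃ x, dist (((n + 1 : ℕ) : ℝ)⁻¹ • (F^[n + 1] x - x)) v ≤
        19 * (((n + 1 : ℕ) : ℝ)⁻¹) := by
      have hpos : 0 < (((n + 1 : ℕ) : ℝ)⁻¹) := by positivity
      obtain ⟨p, hp, hvp⟩ := Metric.mem_closure_iff.1 (hv n) _ hpos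
      obtain ⟨_, ⟨x, rfl⟩, hx⟩ := exists_dist_le_of_mem_convexHull
        (isBounded_averageDisplacements hM (n + 1)) (mul_pos two_pos hpos) (by
          rintro _ ⟨a, rfl⟩ _ ⟨b, rfl⟩
          obtain ⟨z, hz⟩ := exists_dist_displacement_midpoint_le (hF.iterate (n + 1))
            (hinj.iterate (n + 1)) (iterate_add_intCast hper (n + 1)) a b
          refine ⟨_, ⟨z, rfl⟩, ?_⟩
          have hsmul : midpoint ℝ (((n + 1 : ℕ) : ℝ)⁻¹ • (F^[n + 1] a - a))
              (((n + 1 : ℕ) : ℝ)⁻¹ • (F^[n + 1] b - b)) =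
              ((n + 1 : ℕ) : ℝ)⁻¹ • midpoint ℝ (F^[n + 1] a - a) (F^[n + 1] b - b) := by
            simp only [midpoint_eq_smul_add]
            module
          simp only [hsmul]
          rw [dist_smul₀, Real.norm_of_nonneg hpos.le, mul_comm]
          exact mul_le_mul_of_nonneg_right hz hpos.le) hp
      refine ⟨x, (dist_triangle_right _ v p).trans ?_⟩
      simp only [Module.finrank_prod, Module.finrank_self] at hx
      push_cast at hx hvp ⊢
      linarith
    choose x hx using hclose
    refine ⟨fun n => n + 1, x, tendsto_add_atTop_nat 1, ?_⟩
    refine tendsto_iff_dist_tendsto_zero.2 (squeeze_zero (fun _ => dist_nonneg) hx ?_)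
    simpa using (tendsto_inv_atTop_zero.comp ((tendsto_natCast_atTop_atTop (R := ℝ)).comp
      (tendsto_add_atTop_nat 1))).const_mul 19

/-- (Misiurewicz–Ziemian) Let `F : ℝ² → ℝ²` be a homeomorphism commuting with all integer
translations (a lift of a torus homeomorphism isotopic to the identity). Its rotation set
`ρ(F) = {v : ∃ nₖ → ∞, xₖ with (F^[nₖ] xₖ - xₖ)/nₖ → v}` is compact and convex. -/
theorem rotation_set_compact_convex
    (F : (ℝ × ℝ) ≃ₜ (ℝ × ℝ))
    (hF_per : ∀ (x : ℝ × ℝ) (m : ℤ × ℤ),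
      F (x + ((m.1 : ℝ), (m.2 : ℝ))) = F x + ((m.1 : ℝ), (m.2 : ℝ))) :
    IsCompact {v : ℝ × ℝ | ∃ (n : ℕ → ℕ) (x : ℕ → ℝ × ℝ), Tendsto n atTop atTop ∧
        Tendsto (fun k => ((n k : ℝ))⁻¹ • ((⇑F)^[n k] (x k) - x k)) atTop (𝓝 v)} ∧
      Convex ℝ {v : ℝ × ℝ | ∃ (n : ℕ → ℕ) (x : ℕ → ℝ × ℝ), Tendsto n atTop atTop ∧
        Tendsto (fun k => ((n k : ℝ))⁻¹ • ((⇑F)^[n k] (x k) - x k)) atTop (𝓝 v)} := by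
  rw [rotation_set_eq_iInter F.continuous F.injective hF_per]
  obtain ⟨M, hM⟩ := exists_norm_displacement_le F.continuous hF_per
  constructor
  · refine Metric.isCompact_of_isClosed_isBounded (isClosed_iInter fun _ => isClosed_closure) ?_
    exact ((isBounded_convexHull.2 (isBounded_averageDisplacements hM (0 + 1))).closure).subset
      (Set.iInter_subset _ 0)
  · exact convex_iInter fun _ => (convex_convexHull ℝ _).closure
end
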